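/- Let k, λ ∈ ℝ and let Φ : ℝ × ℝ → ℂ be a smooth (C^∞) function whose support is contained in K × ℝ for some compact K ⊂ ℝ. Define Ψ(x,y) = y^{1/2} Φ(x,y) for y > 0, and define the Fourier transform in the first variable by (𝓕Φ)(λ, y) = (1/√(2π)) ∫_ℝ e^{−iλx} Φ(x,y) dx. Then for every y > 0: (1/√(2π)) ∫_ℝ e^{−iλx} · y^{−1/2} · [ y²(∂²Ψ/∂x² + ∂²Ψ/∂y²) + 2iky ∂Ψ/∂x + (1/4)Ψ ](x,y) dx = (y ∂/∂y)² (𝓕Φ)(λ, y) − 2kλ y (𝓕Φ)(λ, y) − λ² y² (𝓕Φ)(λ, y), where (y ∂/∂y)² g(y) = y (d/dy)( y (d/dy) g(y) ). (Proposition 4.1 i): the Fourier transform intertwines the conjugated modified magnetic Schrödinger operator y^{−1/2} 𝒟̃_k y^{1/2} on the hyperbolic half plane with the Morse operator Λ^{λ,k} written in the variable y = e^X.) -/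

import Mathlib

open Real

/-- The modified magnetic Schrödinger operator
`𝒟̃_k Ψ = y²(Ψ_xx + Ψ_yy) + 2iky Ψ_x + (1/4)Ψ` on the upper half plane, applied to a
function `Ψ : ℝ → ℝ → ℂ` at the point `(x, y)`. -/
noncomputable def magneticOp (k : ℝ) (Ψ : ℝ → ℝ → ℂ) (x y : ℝ) : ℂ :=
  (y : ℂ) ^ 2 *
      (deriv (fun s : ℝ => deriv (fun u : ℝ => Ψ u y) s) x +
        deriv (fun s : ℝ => deriv (fun u : ℝ => Ψ x u) s) y) +
    2 * Complex.I * (k : ℂ) * (y : ℂ) * deriv (fun u : ℝ => Ψ u y) x +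
    (1 / 4 : ℂ) * Ψ x y

/-- The Fourier transform in the first variable:
`(𝓕Φ)(λ, y) = (1/√(2π)) ∫ e^{−iλx} Φ(x, y) dx`. -/
noncomputable def fourierFirst (Φ : ℝ → ℝ → ℂ) (lam y : ℝ) : ℂ :=
  (1 / (Real.sqrt (2 * π) : ℂ)) *
    ∫ x : ℝ, Complex.exp (-Complex.I * (lam : ℂ) * (x : ℂ)) * Φ x y

lemma aux_hasDerivAt_fst {G : ℝ → ℝ → ℂ}
    (hG : ContDiff ℝ (⊤ : ℕ∞) (fun p : ℝ × ℝ => G p.1 p.2)) (x y : ℝ) :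
    HasDerivAt (fun u : ℝ => G u y) (fderiv ℝ (fun p : ℝ × ℝ => G p.1 p.2) (x, y) (1, 0)) x := by
  have h1 : HasFDerivAt (fun p : ℝ × ℝ => G p.1 p.2) _ (x, y) :=
    ((hG.differentiable (by simp)) (x, y)).hasFDerivAt
  have h2 : HasDerivAt (fun u : ℝ => (u, y)) ((1 : ℝ), (0 : ℝ)) x :=
    (hasDerivAt_id x).prodMk (hasDerivAt_const x y)
  exact h1.comp_hasDerivAt x h2

lemma aux_hasDerivAt_snd {G : ℝ → ℝ → ℂ}
    (hG : ContDiff ℝ (⊤ : ℕ∞) (fun p : ℝ × ℝ => G p.1 p.2)) (x y : ℝ) :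
    HasDerivAt (fun u : ℝ => G x u) (fderiv ℝ (fun p : ℝ × ℝ => G p.1 p.2) (x, y) (0, 1)) y := by
  have h1 : HasFDerivAt (fun p : ℝ × ℝ => G p.1 p.2) _ (x, y) :=
    ((hG.differentiable (by simp)) (x, y)).hasFDerivAt
  have h2 : HasDerivAt (fun u : ℝ => (x, u)) ((0 : ℝ), (1 : ℝ)) y :=
    (hasDerivAt_const y x).prodMk (hasDerivAt_id y)
  exact h1.comp_hasDerivAt y h2

lemma aux_smooth_fst {G : ℝ → ℝ → ℂ}
    (hG : ContDiff ℝ (⊤ : ℕ∞) (fun p : ℝ × ℝ => G p.1 p.2)) :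
    ContDiff ℝ (⊤ : ℕ∞) (fun p : ℝ × ℝ => deriv (fun u : ℝ => G u p.2) p.1) := by
  have : (fun p : ℝ × ℝ => deriv (fun u : ℝ => G u p.2) p.1) =
      fun p => fderiv ℝ (fun p : ℝ × ℝ => G p.1 p.2) p (1, 0) := by
    funext p
    exact (aux_hasDerivAt_fst hG p.1 p.2).deriv
  rw [this]
  exact (hG.fderiv_right (m := ((⊤ : ℕ∞) : WithTop ℕ∞)) (by simp)).clm_apply contDiff_const

lemma aux_smooth_snd {G : ℝ → ℝ → ℂ}
    (hG : ContDiff ℝ (⊤ : ℕ∞) (fun p : ℝ × ℝ => G p.1 p.2)) :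
    ContDiff ℝ (⊤ : ℕ∞) (fun p : ℝ × ℝ => deriv (fun u : ℝ => G p.1 u) p.2) := by
  have : (fun p : ℝ × ℝ => deriv (fun u : ℝ => G p.1 u) p.2) =
      fun p => fderiv ℝ (fun p : ℝ × ℝ => G p.1 p.2) p (0, 1) := by
    funext p
    exact (aux_hasDerivAt_snd hG p.1 p.2).deriv
  rw [this]
  exact (hG.fderiv_right (m := ((⊤ : ℕ∞) : WithTop ℕ∞)) (by simp)).clm_apply contDiff_const

lemma aux_supp_fst {G : ℝ → ℝ → ℂ} {K : Set ℝ} (hK : IsCompact K)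
    (hs : ∀ x y : ℝ, G x y ≠ 0 → x ∈ K) (x y : ℝ)
    (h : deriv (fun u : ℝ => G u y) x ≠ 0) : x ∈ K := by
  by_contra hx
  apply h
  have : (fun u : ℝ => G u y) =ᶠ[nhds x] fun _ => (0 : ℂ) := by
    filter_upwards [hK.isClosed.isOpen_compl.mem_nhds hx] with u hu
    by_contra h'
    exact hu (hs u y h')
  rw [this.deriv_eq]; simp

lemma aux_supp_snd {G : ℝ → ℝ → ℂ} {K : Set ℝ}
    (hs : ∀ x y : ℝ, G x y ≠ 0 → x ∈ K) (x y : ℝ)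
    (h : deriv (fun u : ℝ => G x u) y ≠ 0) : x ∈ K := by
  by_contra hx
  apply h
  have : (fun u : ℝ => G x u) = fun _ => (0 : ℂ) := by
    funext u
    by_contra h'
    exact hx (hs x u h')
  rw [this]; simp

lemma aux_cont_slice {G : ℝ → ℝ → ℂ}
    (hG : ContDiff ℝ (⊤ : ℕ∞) (fun p : ℝ × ℝ => G p.1 p.2)) (y : ℝ) :
    Continuous (fun x => G x y) :=
  hG.continuous.comp (f := fun x : ℝ => (x, y)) (by fun_prop)

lemma aux_integrable {G : ℝ → ℝ → ℂ} {K : Set ℝ} (hK : IsCompact K)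
    (hG : ContDiff ℝ (⊤ : ℕ∞) (fun p : ℝ × ℝ => G p.1 p.2))
    (hs : ∀ x y : ℝ, G x y ≠ 0 → x ∈ K) {e : ℝ → ℂ} (he : Continuous e) (y : ℝ) :
    MeasureTheory.Integrable (fun x => e x * G x y) := by
  apply (he.mul (aux_cont_slice hG y)).integrable_of_hasCompactSupport
  apply HasCompactSupport.intro hK
  intro x hx
  have : G x y = 0 := by
    by_contra h
    exact hx (hs x y h)
  simp [this]

lemma aux_exp_deriv (lam x : ℝ) :
    HasDerivAt (fun x : ℝ => Complex.exp (-Complex.I * (lam : ℂ) * (x : ℂ)))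
      (Complex.exp (-Complex.I * (lam : ℂ) * (x : ℂ)) * (-Complex.I * (lam : ℂ))) x := by
  have h : HasDerivAt (fun x : ℝ => -Complex.I * (lam : ℂ) * (x : ℂ))
      (-Complex.I * (lam : ℂ)) x := by
    simpa using (Complex.ofRealCLM.hasDerivAt (x := x)).const_mul (-Complex.I * (lam : ℂ))
  exact h.cexp

lemma aux_parts {G : ℝ → ℝ → ℂ} {K : Set ℝ} (hK : IsCompact K)
    (hG : ContDiff ℝ (⊤ : ℕ∞) (fun p : ℝ × ℝ => G p.1 p.2))
    (hs : ∀ x y : ℝ, G x y ≠ 0 → x ∈ K) (lam y : ℝ) :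
    ∫ x : ℝ, Complex.exp (-Complex.I * (lam : ℂ) * (x : ℂ)) * deriv (fun u : ℝ => G u y) x =
      Complex.I * lam * ∫ x : ℝ, Complex.exp (-Complex.I * (lam : ℂ) * (x : ℂ)) * G x y := by
  have hc : Continuous (fun x : ℝ => Complex.exp (-Complex.I * (lam : ℂ) * (x : ℂ))) := by
    fun_prop
  have hc' : Continuous (fun x : ℝ => Complex.exp (-Complex.I * (lam : ℂ) * (x : ℂ)) *
      (-Complex.I * (lam : ℂ))) := by
    fun_prop
  rw [MeasureTheory.integral_mul_deriv_eq_deriv_mul_of_integrable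
    (u := fun x : ℝ => Complex.exp (-Complex.I * (lam : ℂ) * (x : ℂ)))
    (v := fun x => G x y) (fun x _ => aux_exp_deriv lam x)
    (fun x _ => (aux_hasDerivAt_fst hG x y).differentiableAt.hasDerivAt)
    (aux_integrable (G := fun a b => deriv (fun u : ℝ => G u b) a) hK (aux_smooth_fst hG) (aux_supp_fst hK hs) hc y)
    (aux_integrable hK hG hs hc' y) (aux_integrable hK hG hs hc y)]
  rw [← MeasureTheory.integral_const_mul, ← MeasureTheory.integral_neg]
  congr 1
  funext x
  ring

lemma aux_diff {G : ℝ → ℝ → ℂ} {K : Set ℝ} (hK : IsCompact K)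
    (hG : ContDiff ℝ (⊤ : ℕ∞) (fun p : ℝ × ℝ => G p.1 p.2))
    (hs : ∀ x y : ℝ, G x y ≠ 0 → x ∈ K) {e : ℝ → ℂ} (he : Continuous e) (y : ℝ) :
    HasDerivAt (fun y => ∫ x : ℝ, e x * G x y)
      (∫ x : ℝ, e x * deriv (fun u : ℝ => G x u) y) y := by
  have hcont : Continuous (fun p : ℝ × ℝ => e p.1 * deriv (fun u : ℝ => G p.1 u) p.2) :=
    (he.comp continuous_fst).mul (aux_smooth_snd hG).continuous
  obtain ⟨C, hC⟩ := (hK.prod (isCompact_closedBall y 1)).exists_bound_of_continuousOn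
    hcont.continuousOn
  refine (hasDerivAt_integral_of_dominated_loc_of_deriv_le (μ := MeasureTheory.volume)
    (F := fun y x => e x * G x y) (F' := fun y x => e x * deriv (fun u : ℝ => G x u) y)
    (bound := K.indicator (fun _ => C))
    (Metric.ball_mem_nhds y one_pos) ?_ ?_ ?_ ?_ ?_ ?_).2
  · exact Filter.Eventually.of_forall fun z =>
      (aux_integrable hK hG hs he z).aestronglyMeasurable
  · exact aux_integrable hK hG hs he y
  · exact (aux_integrable (G := fun a b => deriv (fun u : ℝ => G a u) b) hK
      (aux_smooth_snd hG) (aux_supp_snd hs) he y).aestronglyMeasurable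
  · refine Filter.Eventually.of_forall fun x z hz => ?_
    by_cases hx : x ∈ K
    · rw [Set.indicator_of_mem hx]
      exact hC (x, z) ⟨hx, Metric.ball_subset_closedBall hz⟩
    · rw [Set.indicator_of_notMem hx]
      have : deriv (fun u : ℝ => G x u) z = 0 := by
        by_contra h
        exact hx (aux_supp_snd hs x z h)
      simp [this]
  · rw [MeasureTheory.integrable_indicator_iff hK.measurableSet]
    exact MeasureTheory.integrableOn_const hK.measure_lt_top.ne
  · refine Filter.Eventually.of_forall fun x z hz => ?_
    exact ((aux_hasDerivAt_snd hG x z).differentiableAt.hasDerivAt).const_mul (e x)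

lemma aux_sqrt (y : ℝ) (hy : 0 < y) :
    HasDerivAt (fun u : ℝ => (Real.sqrt u : ℂ)) ((1 / (2 * Real.sqrt y) : ℝ) : ℂ) y :=
  (Real.hasDerivAt_sqrt hy.ne').ofReal_comp

lemma aux_pointwise {G : ℝ → ℝ → ℂ}
    (hG : ContDiff ℝ (⊤ : ℕ∞) (fun p : ℝ × ℝ => G p.1 p.2)) (k x y : ℝ) (hy : 0 < y) :
    ((Real.sqrt y : ℂ))⁻¹ * magneticOp k (fun x' y' => (Real.sqrt y' : ℂ) * G x' y') x y =
      (y : ℂ) ^ 2 * deriv (fun s : ℝ => deriv (fun u : ℝ => G u y) s) x +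
      (y : ℂ) ^ 2 * deriv (fun s : ℝ => deriv (fun u : ℝ => G x u) s) y +
      (y : ℂ) * deriv (fun u : ℝ => G x u) y +
      2 * Complex.I * (k : ℂ) * (y : ℂ) * deriv (fun u : ℝ => G u y) x := by
  have hsq : (Real.sqrt y : ℂ) ≠ 0 := by
    exact_mod_cast (Real.sqrt_pos.2 hy).ne'
  have hyy : (y : ℂ) = (Real.sqrt y : ℂ) ^ 2 := by
    exact_mod_cast (Real.sq_sqrt hy.le).symm
  have e1 : ∀ s : ℝ, 0 < s → deriv (fun u : ℝ => (Real.sqrt u : ℂ) * G x u) s =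
      (2 * (Real.sqrt s : ℂ))⁻¹ * G x s + (Real.sqrt s : ℂ) * deriv (fun u : ℝ => G x u) s := by
    intro s hs
    rw [((aux_sqrt s hs).fun_mul (aux_hasDerivAt_snd hG x s).differentiableAt.hasDerivAt).deriv]
    push_cast
    ring
  have e2 : deriv (fun s : ℝ => deriv (fun u : ℝ => (Real.sqrt u : ℂ) * G x u) s) y =
      -(4 * (Real.sqrt y : ℂ) ^ 3)⁻¹ * G x y + (Real.sqrt y : ℂ)⁻¹ * deriv (fun u : ℝ => G x u) y
      + (Real.sqrt y : ℂ) * deriv (fun s : ℝ => deriv (fun u : ℝ => G x u) s) y := by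
    have h : (fun s : ℝ => deriv (fun u : ℝ => (Real.sqrt u : ℂ) * G x u) s) =ᶠ[nhds y]
        fun s : ℝ => (2 * (Real.sqrt s : ℂ))⁻¹ * G x s +
          (Real.sqrt s : ℂ) * deriv (fun u : ℝ => G x u) s := by
      filter_upwards [lt_mem_nhds hy] with s hs using e1 s hs
    rw [h.deriv_eq]
    have d1 := (aux_hasDerivAt_snd hG x y).differentiableAt.hasDerivAt
    have d2 := (aux_hasDerivAt_snd (G := fun a b => deriv (fun u : ℝ => G a u) b)
      (aux_smooth_snd hG) x y).differentiableAt.hasDerivAt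
    have d3 := ((aux_sqrt y hy).const_mul (2 : ℂ)).fun_inv (mul_ne_zero two_ne_zero hsq)
    have d4 := (d3.fun_mul d1).fun_add ((aux_sqrt y hy).fun_mul d2)
    rw [d4.deriv]
    push_cast
    field_simp
    ring
  have e3 : ∀ s : ℝ, deriv (fun u : ℝ => (Real.sqrt y : ℂ) * G u y) s =
      (Real.sqrt y : ℂ) * deriv (fun u : ℝ => G u y) s := by
    intro s
    simp
  unfold magneticOp
  simp only [e2, e3, deriv_const_mul_field']
  rw [hyy]
  field_simp
  ring

/-- Proposition 4.1 i): the Fourier transform in the first variable intertwines the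
conjugated modified magnetic Schrödinger operator `y^{−1/2} 𝒟̃_k y^{1/2}` on the
hyperbolic half plane with the Morse operator `(y∂_y)² − 2kλy − λ²y²`. -/
theorem fourier_intertwines_magnetic_and_morse (k lam : ℝ) (Φ : ℝ → ℝ → ℂ)
    (hΦ : ContDiff ℝ (⊤ : ℕ∞) (fun p : ℝ × ℝ => Φ p.1 p.2)) (K : Set ℝ) (hK : IsCompact K)
    (hsupp : ∀ x y : ℝ, Φ x y ≠ 0 → x ∈ K) (y : ℝ) (hy : 0 < y) :
    (1 / (Real.sqrt (2 * π) : ℂ)) *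
        ∫ x : ℝ,
          Complex.exp (-Complex.I * (lam : ℂ) * (x : ℂ)) *
            ((Real.sqrt y : ℂ))⁻¹ *
              magneticOp k (fun x' y' => (Real.sqrt y' : ℂ) * Φ x' y') x y =
      (y : ℂ) *
          deriv (fun s : ℝ => (s : ℂ) * deriv (fun u : ℝ => fourierFirst Φ lam u) s) y -
        2 * (k : ℂ) * (lam : ℂ) * (y : ℂ) * fourierFirst Φ lam y -
        (lam : ℂ) ^ 2 * (y : ℂ) ^ 2 * fourierFirst Φ lam y := by
  set e : ℝ → ℂ := fun x => Complex.exp (-Complex.I * (lam : ℂ) * (x : ℂ)) with he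
  have hc : Continuous e := by
    rw [he]; fun_prop
  have sx := aux_smooth_fst hΦ
  have sy := aux_smooth_snd hΦ
  have px := aux_supp_fst hK hsupp
  have py := aux_supp_snd hsupp
  have sxx := aux_smooth_fst (G := fun a b => deriv (fun u : ℝ => Φ u b) a) sx
  have syy := aux_smooth_snd (G := fun a b => deriv (fun u : ℝ => Φ a u) b) sy
  have pxx := aux_supp_fst (G := fun a b => deriv (fun u : ℝ => Φ u b) a) hK px
  have pyy := aux_supp_snd (G := fun a b => deriv (fun u : ℝ => Φ a u) b) py
  have ix := aux_integrable (G := fun a b => deriv (fun u : ℝ => Φ u b) a) hK sx px hc y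
  have iy := aux_integrable (G := fun a b => deriv (fun u : ℝ => Φ a u) b) hK sy py hc y
  have ixx := aux_integrable (G := fun a b => deriv (fun s : ℝ => deriv (fun u : ℝ => Φ u b) s) a) hK sxx pxx hc y
  have iyy := aux_integrable (G := fun a b => deriv (fun s : ℝ => deriv (fun u : ℝ => Φ a u) s) b) hK syy pyy hc y
  have hL : (∫ x : ℝ, e x * ((Real.sqrt y : ℂ))⁻¹ *
      magneticOp k (fun x' y' => (Real.sqrt y' : ℂ) * Φ x' y') x y) =
      (y : ℂ) ^ 2 * (∫ x : ℝ, e x * deriv (fun s : ℝ => deriv (fun u : ℝ => Φ u y) s) x) +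
      (y : ℂ) ^ 2 * (∫ x : ℝ, e x * deriv (fun s : ℝ => deriv (fun u : ℝ => Φ x u) s) y) +
      (y : ℂ) * (∫ x : ℝ, e x * deriv (fun u : ℝ => Φ x u) y) +
      2 * Complex.I * (k : ℂ) * (y : ℂ) * (∫ x : ℝ, e x * deriv (fun u : ℝ => Φ u y) x) := by
    simp only [← MeasureTheory.integral_const_mul]
    have j1 := ixx.const_mul ((y : ℂ) ^ 2)
    have j2 := iyy.const_mul ((y : ℂ) ^ 2)
    have j3 := iy.const_mul (y : ℂ)
    have j4 := ix.const_mul (2 * Complex.I * (k : ℂ) * (y : ℂ))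
    rw [← MeasureTheory.integral_add j1 j2, ← MeasureTheory.integral_add (j1.fun_add j2) j3,
      ← MeasureTheory.integral_add ((j1.fun_add j2).fun_add j3) j4]
    congr 1
    funext x
    rw [mul_assoc, aux_pointwise hΦ k x y hy]
    ring
  have q1 := aux_parts hK hΦ hsupp lam y
  have q2 := aux_parts (G := fun a b => deriv (fun u : ℝ => Φ u b) a) hK sx px lam y
  have g1 : ∀ s : ℝ, deriv (fun u : ℝ => fourierFirst Φ lam u) s =
      (1 / (Real.sqrt (2 * π) : ℂ)) * ∫ x : ℝ, e x * deriv (fun u : ℝ => Φ x u) s := fun s =>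
    ((aux_diff hK hΦ hsupp hc s).const_mul _).deriv
  have g2 : deriv (fun s : ℝ => (s : ℂ) * deriv (fun u : ℝ => fourierFirst Φ lam u) s) y =
      (1 / (Real.sqrt (2 * π) : ℂ)) * (∫ x : ℝ, e x * deriv (fun u : ℝ => Φ x u) y) +
      (y : ℂ) * ((1 / (Real.sqrt (2 * π) : ℂ)) *
        ∫ x : ℝ, e x * deriv (fun s : ℝ => deriv (fun u : ℝ => Φ x u) s) y) := by
    simp only [g1]
    have d := (aux_diff (G := fun a b => deriv (fun u : ℝ => Φ a u) b) hK sy py hc y).const_mul (1 / (Real.sqrt (2 * π) : ℂ))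
    have d0 : HasDerivAt (fun s : ℝ => (s : ℂ)) 1 y := by
      simpa using (hasDerivAt_id y).ofReal_comp
    rw [(d0.fun_mul d).deriv, one_mul]
  have hF : fourierFirst Φ lam y = (1 / (Real.sqrt (2 * π) : ℂ)) * ∫ x : ℝ, e x * Φ x y := rfl
  change _ = Complex.I * lam * ∫ x : ℝ, e x * Φ x y at q1
  change ∫ x : ℝ, e x * _ = _ at q1
  change ∫ x : ℝ, e x * _ = Complex.I * lam * ∫ x : ℝ, e x * deriv (fun u : ℝ => Φ u y) x at q2
  rw [hL, g2, hF, q2, q1]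
  linear_combination (1 / (Real.sqrt (2 * π) : ℂ)) * (∫ x : ℝ, e x * Φ x y) *
    ((y : ℂ) ^ 2 * lam ^ 2 + 2 * k * y * lam) * Complex.I_sq
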